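/- Let X be a spectral root system such that every minimal point of X lies in the patch closure of the set X^max of maximal points. The following are equivalent: (i) X is Boolean (compact, Hausdorff, and zero-dimensional, i.e. the specialization order is trivial); (ii) qccl(X) is a Stone algebra; (iii) the inverse space X_inv is an Esakia space (hence qccl(X) is a Heyting algebra); (iv) X_inv is a PC-space (hence qccl(X) is pseudocomplemented); (v) X^max is patch closed; (vi) for every U ∈ qcop(X) the set U^max is patch closed; (vii) for all U, V ∈ qcop(X) the set U^max ∩ V is compact; (viii) for every C ∈ qccl(X) the set ↓C is open (equivalently, patch open) in X; (ix) for every C ∈ qccl(X) the set ↓C is clopen in X. -/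

import Mathlib

open Set Topology

namespace PCF

variable {X : Type*}

/-- The compact open subsets of a topological space. -/
def qcop (t : TopologicalSpace X) : Set (Set X) :=
  {U | @IsOpen X t U ∧ @IsCompact X t U}

/-- The complements of the compact open subsets. -/
def qccl (t : TopologicalSpace X) : Set (Set X) :=
  {C | ∃ U ∈ qcop t, C = Uᶜ}

/-- The Boolean algebra of subsets generated by the compact open sets:
the constructible sets. -/
def Constructible (t : TopologicalSpace X) : Set (Set X) :=
  ⋂₀ {B : Set (Set X) | qcop t ⊆ B ∧ (∀ s ∈ B, sᶜ ∈ B) ∧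
        (∀ s ∈ B, ∀ u ∈ B, s ∪ u ∈ B) ∧ (∅ : Set X) ∈ B}

/-- The patch topology: generated by the compact open sets together with their
complements (equivalently, by the constructible sets). -/
def patchTop (t : TopologicalSpace X) : TopologicalSpace X :=
  TopologicalSpace.generateFrom (qcop t ∪ qccl t)

/-- The inverse topology, with the complements of compact opens as a basis of opens. -/
def invTop (t : TopologicalSpace X) : TopologicalSpace X :=
  TopologicalSpace.generateFrom (qccl t)

/-- The specialization order: `x ≤ y` iff `y` is in the closure of `{x}`. -/
def specLE (t : TopologicalSpace X) (x y : X) : Prop := y ∈ @closure X t {x}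

/-- Minimal points for the specialization order. -/
def minPts (t : TopologicalSpace X) : Set X := {x | ∀ y, specLE t y x → y = x}

/-- Maximal points for the specialization order. -/
def maxPts (t : TopologicalSpace X) : Set X := {x | ∀ y, specLE t x y → y = x}

/-- Minimal points of a subset `S`, for the induced specialization order. -/
def minPtsIn (t : TopologicalSpace X) (S : Set X) : Set X :=
  {x | x ∈ S ∧ ∀ y ∈ S, specLE t y x → y = x}

/-- Maximal points of a subset `S`, for the induced specialization order. -/
def maxPtsIn (t : TopologicalSpace X) (S : Set X) : Set X :=
  {x | x ∈ S ∧ ∀ y ∈ S, specLE t x y → y = x}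

/-- The down-set (set of generalizations) generated by `S`. -/
def downset (t : TopologicalSpace X) (S : Set X) : Set X :=
  {x | ∃ s ∈ S, specLE t x s}

/-- The up-set (set of specializations) generated by `S`. -/
def upset (t : TopologicalSpace X) (S : Set X) : Set X :=
  {x | ∃ s ∈ S, specLE t s x}

/-- A topology is spectral if the space is compact, sober (quasi-sober and T0),
the compact opens form a basis, and the compact opens are closed under
finite intersections. -/
def IsSpectral (t : TopologicalSpace X) : Prop :=
  @CompactSpace X t ∧ @QuasiSober X t ∧ @T0Space X t ∧
  @TopologicalSpace.IsTopologicalBasis X t (qcop t) ∧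
  ∀ U ∈ qcop t, ∀ V ∈ qcop t, U ∩ V ∈ qcop t

/-- A Boolean space: compact, Hausdorff and zero-dimensional. -/
def IsBooleanSpace (t : TopologicalSpace X) : Prop :=
  @CompactSpace X t ∧ @T2Space X t ∧
  @TopologicalSpace.IsTopologicalBasis X t {U | @IsClopen X t U}

/-- `V` is the pseudocomplement of `U` in the lattice of sets `L` (ordered by
inclusion, with meet given by intersection and bottom element `∅`): `V` is the
largest element of `L` disjoint from `U`. -/
def IsPseudoCompl (L : Set (Set X)) (U V : Set X) : Prop :=
  V ∈ L ∧ U ∩ V = ∅ ∧ ∀ W ∈ L, U ∩ W = ∅ → W ⊆ V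

/-- The lattice of sets `L` is pseudocomplemented: every element has a
pseudocomplement. -/
def Pseudocomplemented (L : Set (Set X)) : Prop :=
  ∀ U ∈ L, ∃ V, IsPseudoCompl L U V

/-- The lattice of sets `L` is a Stone algebra: it is pseudocomplemented and
`U* ∪ U** = ⊤` for every `U`. -/
def StoneAlgebra (L : Set (Set X)) : Prop :=
  Pseudocomplemented L ∧
  ∀ U ∈ L, ∀ V W : Set X, IsPseudoCompl L U V → IsPseudoCompl L V W → V ∪ W = univ

/-- The lattice of sets `L` is a Heyting algebra: for all `U, V ∈ L` there is a
largest `W ∈ L` with `U ∩ W ⊆ V`. -/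
def HeytingAlg (L : Set (Set X)) : Prop :=
  ∀ U ∈ L, ∀ V ∈ L, ∃ W ∈ L, U ∩ W ⊆ V ∧ ∀ W' ∈ L, U ∩ W' ⊆ V → W' ⊆ W

/-- A PC-space: the lattice of compact open sets is pseudocomplemented. -/
def IsPCSpace (t : TopologicalSpace X) : Prop := Pseudocomplemented (qcop t)

/-- An Esakia space: the closure of every constructible set is constructible. -/
def IsEsakia (t : TopologicalSpace X) : Prop :=
  ∀ S ∈ Constructible t, @closure X t S ∈ Constructible t

/-- A spectral root system: the closure of every point is a specialization chain. -/
def IsRootSystem (t : TopologicalSpace X) : Prop :=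
  ∀ x : X, IsChain (specLE t) (@closure X t {x})

/-- A spectral forest: the inverse space is a spectral root system. -/
def IsForest (t : TopologicalSpace X) : Prop := IsRootSystem (invTop t)

/-- A stranded space: the specialization poset is a disjoint union of chains, i.e.
the set of points comparable with any fixed point is a chain. -/
def Stranded (t : TopologicalSpace X) : Prop :=
  ∀ x : X, IsChain (specLE t) {y | specLE t x y ∨ specLE t y x}

end PCF

open PCF

section Rings

variable (T : Type*) [TopologicalSpace T]

/-- The zero set of a continuous real-valued function. -/
def zeroSet (f : ContinuousMap T ℝ) : Set T := {t | f t = 0}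

/-- The lattice of cozero sets of a topological space. -/
def Coz : Set (Set T) := {U | ∃ f : ContinuousMap T ℝ, U = {t | f t ≠ 0}}

/-- A z-ideal of the ring `C(T)` of continuous real-valued functions. -/
def IsZIdeal (I : Ideal (ContinuousMap T ℝ)) : Prop :=
  ∀ f ∈ I, ∀ g : ContinuousMap T ℝ, zeroSet T f ⊆ zeroSet T g → g ∈ I

/-- The prime z-ideals, as a subset of the prime spectrum of `C(T)`. -/
def zSpec : Set (PrimeSpectrum (ContinuousMap T ℝ)) :=
  {p | IsZIdeal T p.asIdeal}

/-- A space is basically disconnected if the closure of every cozero set is open. -/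
def BasicallyDisconnected : Prop :=
  ∀ f : ContinuousMap T ℝ, IsOpen (closure {t | f t ≠ 0})

/-- The Zariski topology on the prime spectrum of `C(T)`. -/
def specTop : TopologicalSpace (PrimeSpectrum (ContinuousMap T ℝ)) := inferInstance

/-- The subspace topology on the set of prime z-ideals. -/
def zTop : TopologicalSpace ↥(zSpec T) := inferInstance

end Rings

/-- The subspace topology on a subset. -/
def subTop {Y : Type*} [TopologicalSpace Y] (X : Set Y) : TopologicalSpace ↥X :=
  inferInstance

namespace PCF

theorem exists_finite_sUnion_of_isCompact {X : Type*} [TopologicalSpace X] {S : Set X}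
    (hS : IsCompact S) {A : Set (Set X)} (hA : ∀ U ∈ A, IsOpen U) (hSA : S ⊆ ⋃₀ A) :
    ∃ T ⊆ A, T.Finite ∧ S ⊆ ⋃₀ T := by
  simp only [sUnion_eq_biUnion] at hSA ⊢
  exact hS.elim_finite_subcover_image hA hSA

/-- Every ultrafilter on a spectral space has a limit in the patch topology. -/
theorem IsSpectral.exists_patch_limit {X : Type*} [t : TopologicalSpace X] (hX : IsSpectral t)
    (F : Ultrafilter X) : ∃ x, ∀ V ∈ qcop t, x ∈ V ↔ V ∈ F := by
  obtain ⟨hcomp, hsober, -, hbasis, hinter⟩ := hX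
  set Z : Set X := ⋂₀ {C | ∃ V ∈ qcop t, V ∉ F ∧ C = Vᶜ}
  have hZclosed : IsClosed Z := by
    refine isClosed_sInter ?_
    rintro _ ⟨V, hV, -, rfl⟩
    exact hV.1.isClosed_compl
  have hmeet : ∀ V ∈ qcop t, V ∈ F ↔ (Z ∩ V).Nonempty := by
    intro V hV
    refine ⟨fun hVF => ?_, ?_⟩
    · by_contra hempty
      have hcover : V ⊆ ⋃₀ {W | W ∈ qcop t ∧ W ∉ F} := by
        intro y hy
        by_contra hyW
        refine hempty ⟨y, ?_, hy⟩
        rintro _ ⟨W, hW, hWF, rfl⟩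
        exact fun hyW' => hyW ⟨W, ⟨hW, hWF⟩, hyW'⟩
      obtain ⟨T, hT, hTfin, hVT⟩ :=
        exists_finite_sUnion_of_isCompact hV.2 (fun W hW => hW.1.1) hcover
      obtain ⟨W, hW, hWF⟩ :=
        (Ultrafilter.finite_sUnion_mem_iff hTfin).1 (F.mem_of_superset hVF hVT)
      exact (hT hW).2 hWF
    · rintro ⟨y, hyZ, hyV⟩
      by_contra hVF
      exact hyZ Vᶜ ⟨V, hV, hVF, rfl⟩ hyV
  have hZirr : IsIrreducible Z := by
    refine ⟨?_, ?_⟩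
    · obtain ⟨y, hy, -⟩ := (hmeet univ ⟨isOpen_univ, isCompact_univ⟩).1 Filter.univ_mem
      exact ⟨y, hy⟩
    · rintro A B hA hB ⟨a, haZ, haA⟩ ⟨b, hbZ, hbB⟩
      obtain ⟨V, hV, haV, hVA⟩ := hbasis.exists_subset_of_mem_open haA hA
      obtain ⟨W, hW, hbW, hWB⟩ := hbasis.exists_subset_of_mem_open hbB hB
      have hVF := (hmeet V hV).2 ⟨a, haZ, haV⟩
      have hWF := (hmeet W hW).2 ⟨b, hbZ, hbW⟩
      exact ((hmeet _ (hinter V hV W hW)).1 (Filter.inter_mem hVF hWF)).mono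
        (inter_subset_inter_right _ (inter_subset_inter hVA hWB))
  obtain ⟨x, hx⟩ := hsober.sober hZirr hZclosed
  refine ⟨x, fun V hV => ?_⟩
  rw [hmeet V hV]
  exact (hx.mem_open_set_iff hV.1)

section Spectral

variable {X : Type*} [t : TopologicalSpace X]

theorem mem_qcop_iff_isClopen_of_t2 [CompactSpace X] [T2Space X] {U : Set X} :
    U ∈ qcop t ↔ IsClopen U :=
  ⟨fun h => ⟨h.2.isClosed, h.1⟩, fun h => ⟨h.2, h.1.isCompact⟩⟩

theorem union_mem_qcop {U V : Set X} (hU : U ∈ qcop t) (hV : V ∈ qcop t) :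
    U ∪ V ∈ qcop t :=
  ⟨hU.1.union hV.1, hU.2.union hV.2⟩

theorem IsSpectral.univ_mem_qcop (hX : IsSpectral t) : univ ∈ qcop t :=
  have := hX.1
  ⟨isOpen_univ, isCompact_univ⟩

theorem IsSpectral.specLE_iff (hX : IsSpectral t) {x y : X} :
    specLE t x y ↔ ∀ V ∈ qcop t, y ∈ V → x ∈ V := by
  rw [specLE, hX.2.2.2.1.mem_closure_iff]
  simp only [inter_singleton_nonempty]

theorem IsSpectral.specLE_antisymm (hX : IsSpectral t) {x y : X} (hxy : specLE t x y)
    (hyx : specLE t y x) : x = y := by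
  have := hX.2.2.1
  exact ((specializes_iff_mem_closure.2 hxy).antisymm (specializes_iff_mem_closure.2 hyx)).eq

theorem IsSpectral.exists_qcop_of_not_specLE (hX : IsSpectral t) {x y : X}
    (h : ¬ specLE t x y) : ∃ V ∈ qcop t, y ∈ V ∧ x ∉ V := by
  rw [hX.specLE_iff] at h
  push Not at h
  exact h

theorem IsSpectral.exists_maxPts_specLE (hX : IsSpectral t) (x : X) :
    ∃ m ∈ maxPts t, specLE t x m := by
  have := hX.1
  have := hX.2.2.1
  obtain ⟨m, hm, hmc⟩ := IsClosed.exists_closed_singleton (isClosed_closure (s := {x}))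
    (closure_nonempty_iff.2 (singleton_nonempty x))
  exact ⟨m, fun y hy => by simpa [specLE, hmc.closure_eq] using hy, hm⟩

theorem IsSpectral.exists_minPts_specLE (hX : IsSpectral t) (x : X) :
    ∃ y ∈ minPts t, specLE t y x := by
  obtain ⟨y, hy⟩ := hX.2.1.sober (isIrreducible_irreducibleComponent (x := x))
    isClosed_irreducibleComponent
  have hcl : closure {y} = irreducibleComponent x := hy
  refine ⟨y, fun z hz => ?_, ?_⟩
  · have hsub : irreducibleComponent x ⊆ closure {z} := by
      rw [← hcl]
      exact closure_minimal (singleton_subset_iff.2 hz) isClosed_closure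
    have heq := eq_irreducibleComponent
      (isIrreducible_singleton.closure (s := {z})).isPreirreducible hsub
    refine hX.specLE_antisymm hz ?_
    rw [specLE, hcl, ← heq]
    exact subset_closure rfl
  · rw [specLE, hcl]
    exact mem_irreducibleComponent

/-- The patch closure is described by ultrafilters. -/
theorem mem_patch_closure {S : Set X} {x : X} (h : x ∈ @closure X (patchTop t) S) :
    ∃ F : Ultrafilter X, S ∈ F ∧ ∀ V ∈ qcop t, x ∈ V ↔ V ∈ F := by
  obtain ⟨F, hSF, hF⟩ := (@mem_closure_iff_ultrafilter X x S (patchTop t)).1 h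
  have hmem : ∀ V ∈ qcop t ∪ qccl t, x ∈ V → V ∈ F := fun V hV hx =>
    hF (@IsOpen.mem_nhds X (patchTop t) x V (TopologicalSpace.isOpen_generateFrom_of_mem hV) hx)
  refine ⟨F, hSF, fun V hV => ⟨hmem V (.inl hV), fun hVF => ?_⟩⟩
  by_contra hx
  exact Ultrafilter.compl_notMem_iff.2 hVF (hmem Vᶜ (.inr ⟨V, hV, rfl⟩) hx)

theorem patch_isClosed_of_forall_ultrafilter {S : Set X}
    (h : ∀ x, ∀ F : Ultrafilter X, S ∈ F → (∀ V ∈ qcop t, x ∈ V ↔ V ∈ F) → x ∈ S) :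
    IsClosed[patchTop t] S := by
  refine (@closure_subset_iff_isClosed X (patchTop t) S).1 fun x hx => ?_
  obtain ⟨F, hSF, hF⟩ := mem_patch_closure hx
  exact h x F hSF hF

theorem IsSpectral.specLE_of_le_nhds (hX : IsSpectral t) {F : Ultrafilter X} {x y : X}
    (hx : ∀ V ∈ qcop t, x ∈ V ↔ V ∈ F) (hy : ↑F ≤ 𝓝 y) : specLE t x y :=
  hX.specLE_iff.2 fun V hV hyV => (hx V hV).2 (hy (hV.1.mem_nhds hyV))

theorem le_nhds_invTop {F : Ultrafilter X} {x : X} (hx : ∀ V ∈ qcop t, x ∈ V ↔ V ∈ F) :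
    ↑F ≤ @nhds X (invTop t) x := by
  rw [invTop, TopologicalSpace.nhds_generateFrom]
  refine le_iInf₂ fun s hs => Filter.le_principal_iff.2 ?_
  obtain ⟨hxs, V, hV, rfl⟩ := hs
  exact Ultrafilter.compl_mem_iff_notMem.2 fun hVF => hxs ((hx V hV).2 hVF)

/-- A set open in the inverse topology and closed in the patch topology is compact in the
inverse topology. -/
theorem IsSpectral.isCompact_invTop (hX : IsSpectral t) {S : Set X}
    (hS : ∀ x, ∀ F : Ultrafilter X, S ∈ F → (∀ V ∈ qcop t, x ∈ V ↔ V ∈ F) → x ∈ S) :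
    @IsCompact X (invTop t) S := by
  refine (@isCompact_iff_ultrafilter_le_nhds X (invTop t) S).2 fun F hF => ?_
  obtain ⟨x, hx⟩ := hX.exists_patch_limit F
  exact ⟨x, hS x F (Filter.le_principal_iff.1 hF) hx, le_nhds_invTop hx⟩

theorem inter_mem_qccl {C D : Set X} (hC : C ∈ qccl t) (hD : D ∈ qccl t) :
    C ∩ D ∈ qccl t := by
  obtain ⟨U, hU, rfl⟩ := hC
  obtain ⟨V, hV, rfl⟩ := hD
  exact ⟨U ∪ V, union_mem_qcop hU hV, (compl_union U V).symm⟩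

theorem IsSpectral.union_mem_qccl (hX : IsSpectral t) {C D : Set X} (hC : C ∈ qccl t)
    (hD : D ∈ qccl t) : C ∪ D ∈ qccl t := by
  obtain ⟨U, hU, rfl⟩ := hC
  obtain ⟨V, hV, rfl⟩ := hD
  exact ⟨U ∩ V, hX.2.2.2.2 U hU V hV, (compl_inter U V).symm⟩

theorem univ_mem_qccl : (univ : Set X) ∈ qccl t :=
  ⟨∅, ⟨isOpen_empty, isCompact_empty⟩, compl_empty.symm⟩

theorem IsSpectral.empty_mem_qccl (hX : IsSpectral t) : (∅ : Set X) ∈ qccl t :=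
  ⟨univ, hX.univ_mem_qcop, compl_univ.symm⟩

theorem isTopologicalBasis_qccl :
    @TopologicalSpace.IsTopologicalBasis X (invTop t) (qccl t) :=
  letI := invTop t
  { exists_subset_inter := fun C hC D hD _ hx =>
      ⟨C ∩ D, inter_mem_qccl (t := t) hC hD, hx, subset_rfl⟩
    sUnion_eq := eq_univ_of_univ_subset (subset_sUnion_of_mem (univ_mem_qccl (t := t)))
    eq_generateFrom := rfl }

theorem IsSpectral.qcop_invTop (hX : IsSpectral t) : qcop (invTop t) = qccl t := by
  refine Subset.antisymm ?_ ?_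
  · rintro S ⟨hSo, hSc⟩
    have hcover : S ⊆ ⋃₀ {C | C ∈ qccl t ∧ C ⊆ S} := by
      intro x hx
      obtain ⟨C, hC, hxC, hCS⟩ :=
        (@TopologicalSpace.IsTopologicalBasis.exists_subset_of_mem_open X (invTop t) _
          isTopologicalBasis_qccl x S hx hSo)
      exact ⟨C, ⟨hC, hCS⟩, hxC⟩
    obtain ⟨T, hT, hTfin, hST⟩ := @exists_finite_sUnion_of_isCompact X (invTop t) S hSc _
      (fun C hC => TopologicalSpace.isOpen_generateFrom_of_mem hC.1) hcover
    have hSeq : S = ⋃₀ T := hST.antisymm (sUnion_subset fun C hC => (hT hC).2)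
    have hfin : ∀ T' : Set (Set X), T'.Finite → T' ⊆ qccl t → ⋃₀ T' ∈ qccl t := by
      intro T' hT'
      induction T', hT' using Set.Finite.induction_on with
      | empty => exact fun _ => by simpa using hX.empty_mem_qccl
      | insert _ _ ih =>
        intro hsub
        rw [sUnion_insert]
        exact hX.union_mem_qccl (hsub (mem_insert _ _)) (ih ((subset_insert _ _).trans hsub))
    rw [hSeq]
    exact hfin T hTfin fun C hC => (hT hC).1
  · rintro _ ⟨V, hV, rfl⟩
    refine ⟨TopologicalSpace.isOpen_generateFrom_of_mem ⟨V, hV, rfl⟩, hX.isCompact_invTop ?_⟩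
    intro x F hF hx hxV
    exact Ultrafilter.compl_mem_iff_notMem.1 hF ((hx V hV).1 hxV)

/-- Constructible sets of the inverse space are clopen in the patch topology. -/
theorem IsSpectral.constructible_invTop_patch_limit (hX : IsSpectral t) {S : Set X}
    (hS : S ∈ Constructible (invTop t)) {x : X} {F : Ultrafilter X}
    (hx : ∀ V ∈ qcop t, x ∈ V ↔ V ∈ F) : x ∈ S ↔ S ∈ F := by
  refine hS {S | x ∈ S ↔ S ∈ F} ⟨?_, ?_, ?_, ?_⟩
  · rw [hX.qcop_invTop]
    rintro _ ⟨V, hV, rfl⟩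
    exact (not_congr (hx V hV)).trans Ultrafilter.compl_mem_iff_notMem.symm
  · exact fun s hs => (not_congr hs).trans Ultrafilter.compl_mem_iff_notMem.symm
  · exact fun s hs u hu => (or_congr hs hu).trans Ultrafilter.union_mem_iff.symm
  · exact ⟨False.elim, fun h => (Ultrafilter.empty_notMem h).elim⟩

theorem IsSpectral.isPCSpace_invTop_of_isEsakia (hX : IsSpectral t)
    (h : IsEsakia (invTop t)) : IsPCSpace (invTop t) := by
  intro C hC
  have hcon : C ∈ Constructible (invTop t) := fun B hB => hB.1 hC
  have hcl := h C hcon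
  refine ⟨(@closure X (invTop t) C)ᶜ, ⟨?_, ?_⟩, ?_, ?_⟩
  · exact (@isClosed_closure X (invTop t) C).isOpen_compl
  · refine hX.isCompact_invTop fun x F hF hx hxC => ?_
    exact Ultrafilter.compl_mem_iff_notMem.1 hF
      ((hX.constructible_invTop_patch_limit hcl hx).1 hxC)
  · exact disjoint_iff_inter_eq_empty.1
      (disjoint_compl_right_iff_subset.2 (@subset_closure X (invTop t) C))
  · intro W hW hCW
    have hdisj := @Disjoint.closure_left X (invTop t) C W (disjoint_iff_inter_eq_empty.2 hCW) hW.1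
    exact hdisj.subset_compl_left

theorem IsSpectral.exists_qcop_of_notMem_downset (hX : IsSpectral t) {C : Set X}
    (hC : C ∈ qccl t) {x : X} (hx : x ∉ downset t C) : ∃ V ∈ qcop t, C ⊆ V ∧ x ∉ V := by
  have := hX.1
  obtain ⟨U, hU, rfl⟩ := hC
  refine IsCompact.induction_on (p := fun S => ∃ V ∈ qcop t, S ⊆ V ∧ x ∉ V)
    hU.1.isClosed_compl.isCompact ⟨∅, ⟨isOpen_empty, isCompact_empty⟩, subset_rfl, notMem_empty x⟩
    ?_ ?_ ?_
  · rintro S T hST ⟨V, hV, hTV, hxV⟩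
    exact ⟨V, hV, hST.trans hTV, hxV⟩
  · rintro S T ⟨V, hV, hSV, hxV⟩ ⟨W, hW, hTW, hxW⟩
    exact ⟨V ∪ W, union_mem_qcop hV hW, union_subset_union hSV hTW,
      fun h => h.elim hxV hxW⟩
  · intro c hc
    obtain ⟨V, hV, hcV, hxV⟩ := hX.exists_qcop_of_not_specLE fun h => hx ⟨c, hc, h⟩
    exact ⟨V, mem_nhdsWithin_of_mem_nhds (hV.1.mem_nhds hcV), V, hV, subset_rfl, hxV⟩

theorem IsSpectral.isOpen_downset_of_isPCSpace_invTop (hX : IsSpectral t)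
    (h : IsPCSpace (invTop t)) {C : Set X} (hC : C ∈ qccl t) : IsOpen (downset t C) := by
  rw [IsPCSpace, hX.qcop_invTop] at h
  obtain ⟨_, ⟨V, hV, rfl⟩, hCV, hmax⟩ := h C hC
  have hsub : C ⊆ V := disjoint_compl_right_iff_subset.1 (disjoint_iff_inter_eq_empty.2 hCV)
  suffices downset t C = V from this ▸ hV.1
  refine Subset.antisymm ?_ fun x hxV => ?_
  · rintro x ⟨c, hc, hxc⟩
    exact hX.specLE_iff.1 hxc V hV (hsub hc)
  · by_contra hx
    obtain ⟨W, hW, hCW, hxW⟩ := hX.exists_qcop_of_notMem_downset hC hx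
    exact hmax Wᶜ ⟨W, hW, rfl⟩ (disjoint_iff_inter_eq_empty.1
      (disjoint_compl_right_iff_subset.2 hCW)) hxW hxV

theorem IsSpectral.isClosed_maxPts_of_isOpen_downset (hX : IsSpectral t)
    (h : ∀ C ∈ qccl t, IsOpen (downset t C)) : IsClosed[patchTop t] (maxPts t) := by
  refine patch_isClosed_of_forall_ultrafilter fun x F hF hx => ?_
  obtain ⟨m, hm, hxm⟩ := hX.exists_maxPts_specLE x
  suffices specLE t m x from (hX.specLE_antisymm hxm this) ▸ hm
  by_contra hmx
  obtain ⟨U, hU, hxU, hmU⟩ := hX.exists_qcop_of_not_specLE hmx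
  obtain ⟨V, hV, hxV, hVsub⟩ := hX.2.2.2.1.exists_subset_of_mem_open
    (⟨m, hmU, hxm⟩ : x ∈ downset t Uᶜ) (h _ ⟨U, hU, rfl⟩)
  obtain ⟨y, ⟨hyV, hyU⟩, hymax⟩ := F.nonempty_of_mem
    (Filter.inter_mem (Filter.inter_mem ((hx V hV).1 hxV) ((hx U hU).1 hxU)) hF)
  obtain ⟨c, hcU, hyc⟩ := hVsub hyV
  exact hcU (hymax c hyc ▸ hyU)

theorem maxPtsIn_univ : maxPtsIn t univ = maxPts t := by
  simp [maxPtsIn, maxPts]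

theorem IsSpectral.isClosed_maxPts_of_isCompact (hX : IsSpectral t) (hroot : IsRootSystem t)
    (h : ∀ V ∈ qcop t, IsCompact (maxPts t ∩ V)) : IsClosed[patchTop t] (maxPts t) := by
  refine patch_isClosed_of_forall_ultrafilter fun x F hF hx => ?_
  have hlim : ∀ V ∈ qcop t, x ∈ V → ∃ m ∈ maxPts t ∩ V, specLE t x m := by
    intro V hV hxV
    obtain ⟨m, hm, hFm⟩ := (h V hV).ultrafilter_le_nhds F
      (Filter.le_principal_iff.2 (Filter.inter_mem hF ((hx V hV).1 hxV)))
    exact ⟨m, hm, hX.specLE_of_le_nhds hx hFm⟩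
  obtain ⟨m, hm, hxm⟩ := hX.exists_maxPts_specLE x
  suffices specLE t m x from (hX.specLE_antisymm hxm this) ▸ hm
  refine hX.specLE_iff.2 fun V hV hxV => ?_
  obtain ⟨m', ⟨hm', hm'V⟩, hxm'⟩ := hlim V hV hxV
  suffices m = m' from this ▸ hm'V
  by_contra hne
  rcases hroot x hxm hxm' hne with hle | hle
  · exact hne (hm m' hle).symm
  · exact hne (hm' m hle)

theorem IsSpectral.isBooleanSpace_of_minPts_subset_maxPts (hX : IsSpectral t)
    (h : minPts t ⊆ maxPts t) : IsBooleanSpace t := by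
  have hcomp := hX.1
  have htriv : ∀ x y, specLE t x y → x = y := by
    intro x y hxy
    obtain ⟨z, hz, hzx⟩ := hX.exists_minPts_specLE x
    obtain rfl := h hz x hzx
    exact (h hz y hxy).symm
  have hclosed : ∀ V ∈ qcop t, IsClosed V := by
    refine fun V hV => isClosed_iff_ultrafilter.2 fun x F hFx hVF => ?_
    obtain ⟨y, hy⟩ := hX.exists_patch_limit F
    exact htriv y x (hX.specLE_of_le_nhds hy hFx) ▸ (hy V hV).2 hVF
  have hqcop : qcop t = {U | IsClopen U} :=
    Set.ext fun U => ⟨fun hU => ⟨hclosed U hU, hU.1⟩, fun hU => ⟨hU.2, hU.1.isCompact⟩⟩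
  refine ⟨hcomp, ⟨fun x y hxy => ?_⟩, hqcop ▸ hX.2.2.2.1⟩
  obtain ⟨V, hV, hyV, hxV⟩ := hX.exists_qcop_of_not_specLE fun hle => hxy (htriv x y hle)
  exact ⟨Vᶜ, V, (hclosed V hV).isOpen_compl, hV.1, hxV, hyV, disjoint_compl_left⟩

end Spectral

section Boolean

variable {X : Type*} [t : TopologicalSpace X]

theorem specLE_iff_eq_of_t1 [T1Space X] {x y : X} : specLE t x y ↔ y = x := by
  simp [specLE]

theorem downset_eq_of_t1 [T1Space X] (S : Set X) : downset t S = S := by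
  ext x
  simp [downset, specLE_iff_eq_of_t1]

theorem maxPtsIn_eq_of_t1 [T1Space X] (S : Set X) : maxPtsIn t S = S := by
  ext x
  simp +contextual [maxPtsIn, specLE_iff_eq_of_t1]

theorem IsBooleanSpace.qcop_eq (h : IsBooleanSpace t) : qcop t = {U | IsClopen U} :=
  have := h.1
  have := h.2.1
  Set.ext fun _ => mem_qcop_iff_isClopen_of_t2

theorem IsBooleanSpace.qccl_eq (h : IsBooleanSpace t) : qccl t = {U | IsClopen U} := by
  ext C
  rw [qccl, h.qcop_eq]
  exact ⟨fun ⟨U, hU, hC⟩ => hC ▸ IsClopen.compl hU,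
    fun hC => ⟨Cᶜ, IsClopen.compl hC, (compl_compl C).symm⟩⟩

theorem IsBooleanSpace.invTop_eq (h : IsBooleanSpace t) : invTop t = t := by
  rw [invTop, h.qccl_eq, ← h.2.2.eq_generateFrom]

theorem isPseudoCompl_isClopen_iff {U V : Set X} (hU : IsClopen U) :
    IsPseudoCompl {U | IsClopen U} U V ↔ V = Uᶜ := by
  refine ⟨fun ⟨_, hUV, hmax⟩ => ?_, ?_⟩
  · exact Subset.antisymm (disjoint_iff_inter_eq_empty.2 hUV).subset_compl_left
      (hmax _ hU.compl (inter_compl_self U))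
  · rintro rfl
    exact ⟨hU.compl, inter_compl_self U,
      fun W _ hW => (disjoint_iff_inter_eq_empty.2 hW).subset_compl_left⟩

theorem IsBooleanSpace.stoneAlgebra_qccl (h : IsBooleanSpace t) : StoneAlgebra (qccl t) := by
  rw [h.qccl_eq]
  refine ⟨fun U hU => ⟨Uᶜ, (isPseudoCompl_isClopen_iff hU).2 rfl⟩, fun U hU V W hV hW => ?_⟩
  rw [(isPseudoCompl_isClopen_iff hV.1).1 hW, union_compl_self]

theorem IsBooleanSpace.isEsakia (h : IsBooleanSpace t) : IsEsakia t := by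
  intro S hS
  have hclopen : IsClopen S := hS {U | IsClopen U} ⟨h.qcop_eq.subset,
    fun _ hs => hs.compl, fun _ hs _ hu => hs.union hu, isClopen_empty⟩
  rwa [hclopen.1.closure_eq]

theorem IsBooleanSpace.patch_isClosed_of_isClopen (h : IsBooleanSpace t) {S : Set X}
    (hS : IsClopen S) : IsClosed[patchTop t] S := by
  refine (@isOpen_compl_iff X S (patchTop t)).1
    (TopologicalSpace.isOpen_generateFrom_of_mem (.inl ?_))
  rw [h.qcop_eq]
  exact hS.compl

end Boolean

end PCF

/-- For a spectral root system `X` in which every minimal point lies in the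
patch closure of `X^max`, TFAE: (i) `X` is Boolean; (ii) `qccl X` is a Stone algebra;
(iii) the inverse space of `X` is an Esakia space; (iv) the inverse space of `X` is a
PC-space; (v) `X^max` is patch closed; (vi) `U^max` is patch closed for all compact open
`U`; (vii) `U^max ∩ V` is compact for all compact open `U, V`; (viii) `↓C` is open for
every `C ∈ qccl X`; (ix) `↓C` is clopen for every `C ∈ qccl X`. -/
theorem statement_8 {X : Type*} [t : TopologicalSpace X] (hX : IsSpectral t)
    (hroot : IsRootSystem t)
    (hmin : minPts t ⊆ @closure X (patchTop t) (maxPts t)) :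
    List.TFAE
      [ IsBooleanSpace t,
        StoneAlgebra (qccl t),
        IsEsakia (invTop t),
        IsPCSpace (invTop t),
        IsClosed[patchTop t] (maxPts t),
        ∀ U ∈ qcop t, IsClosed[patchTop t] (maxPtsIn t U),
        ∀ U ∈ qcop t, ∀ V ∈ qcop t, IsCompact (maxPtsIn t U ∩ V),
        ∀ C ∈ qccl t, IsOpen (downset t C),
        ∀ C ∈ qccl t, IsClopen (downset t C) ] := by
  have hBoolean : IsBooleanSpace t → ∀ U ∈ qcop t, IsClopen U := fun h U hU =>
    h.qcop_eq.subset hU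
  tfae_have 1 → 2 := IsBooleanSpace.stoneAlgebra_qccl
  tfae_have 1 → 3 := fun h => h.invTop_eq.symm ▸ h.isEsakia
  tfae_have 1 → 6 := fun h U hU => by
    have := h.2.1
    rw [maxPtsIn_eq_of_t1]
    exact h.patch_isClosed_of_isClopen (hBoolean h U hU)
  tfae_have 1 → 7 := fun h U hU V hV => by
    have := h.2.1
    rw [maxPtsIn_eq_of_t1]
    exact (hX.2.2.2.2 U hU V hV).2
  tfae_have 1 → 9 := fun h C hC => by
    have := h.2.1
    rw [downset_eq_of_t1]
    exact h.qccl_eq.subset hC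
  tfae_have 2 → 4 := fun h => by
    rw [IsPCSpace, hX.qcop_invTop]
    exact h.1
  tfae_have 3 → 4 := hX.isPCSpace_invTop_of_isEsakia
  tfae_have 4 → 8 := fun h _ hC => hX.isOpen_downset_of_isPCSpace_invTop h hC
  tfae_have 9 → 8 := fun h C hC => (h C hC).2
  tfae_have 8 → 5 := hX.isClosed_maxPts_of_isOpen_downset
  tfae_have 6 → 5 := fun h => maxPtsIn_univ (t := t) ▸ h univ hX.univ_mem_qcop
  tfae_have 7 → 5 := fun h => hX.isClosed_maxPts_of_isCompact hroot
    (maxPtsIn_univ (t := t) ▸ h univ hX.univ_mem_qcop)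
  tfae_have 5 → 1 := fun h => hX.isBooleanSpace_of_minPts_subset_maxPts
    (hmin.trans (@IsClosed.closure_eq X (patchTop t) _ h).subset)
  tfae_finish
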